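/- arXiv:1504.00373 — 2 statements merged into one kernel-verified Lean document; each statement's English description precedes it below -/
import Mathlib

section
/- Let F be an algebraically closed field of characteristic zero, G a finite group with identity e, and W a unitary affine G-graded F-algebra satisfying a nontrivial ordinary polynomial identity. Fix n and let R_n^G(W) and B_n be as defined. Then for every α ∈ ℕ^n, dim_F (R_n^G(W))^α = Σ_{β∈ℕ^n, β_i ≤ α_i for all i} dim_F B_n^β. (Equivalently, R_n^G(W) ≅ F[z₁,…,z_n] ⊗ B_n as ℕ^n-graded vector spaces.) -/
open Filter

noncomputable section Defs

variable (F : Type) [Field F] (G : Type) [Group G] (W : Type) [Ring W] [Algebra F W]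

/-- The graded identities of `W` in `n` graded variables: the polynomials in the free
algebra `F⟨x_{i,g} : 1 ≤ i ≤ n, g ∈ G⟩` vanishing under every admissible substitution. -/
def IdU (grading : G → Submodule F W) (n : ℕ) : Submodule F (FreeAlgebra F (Fin n × G)) :=
  ⨅ a : {a : Fin n × G → W // ∀ p : Fin n × G, a p ∈ grading p.2},
    LinearMap.ker (FreeAlgebra.lift F a.1).toLinearMap

/-- The monomial associated to a word in the variables. -/
def monOf {n : ℕ} (l : List (Fin n × G)) : FreeAlgebra F (Fin n × G) :=
  (l.map (FreeAlgebra.ι F)).prod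

/-- The multidegree of a word: the number of occurrences of variables with index `i`. -/
def listDeg {G : Type} {n : ℕ} (l : List (Fin n × G)) : Fin n → ℕ :=
  fun i => (l.map Prod.fst).count i

/-- The span of the monomials of multidegree `α` in the free algebra. -/
def Adeg (n : ℕ) (α : Fin n → ℕ) : Submodule F (FreeAlgebra F (Fin n × G)) :=
  Submodule.span F {x | ∃ l : List (Fin n × G), listDeg l = α ∧ x = monOf F G l}

/-- The multidegree-`α` component of the relatively free algebra `R_n^G(W)`. -/
def RnDeg (grading : G → Submodule F W) (n : ℕ) (α : Fin n → ℕ) :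
    Submodule F (FreeAlgebra F (Fin n × G) ⧸ IdU F G W grading n) :=
  Submodule.map (IdU F G W grading n).mkQ (Adeg F G n α)

/-- The `n`-th `G`-graded codimension of `W`: the dimension of the multilinear
component of the relatively free algebra. -/
def cnG (grading : G → Submodule F W) (n : ℕ) : ℕ :=
  Module.finrank F ↥(RnDeg F G W grading n (fun _ => 1))

/-- `W` satisfies a nontrivial ordinary polynomial identity. -/
def SatisfiesOrdinaryPI : Prop :=
  ∃ f : FreeAlgebra F ℕ, f ≠ 0 ∧ ∀ a : ℕ → W, FreeAlgebra.lift F a f = 0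

/-- Left-normed iterated commutator `[a, b₁, …, b_m]`. -/
def lcomm {R : Type} [NonUnitalNonAssocRing R] : R → List R → R
  | a, [] => a
  | a, b :: l => lcomm (a * b - b * a) l

/-- Left-normed commutator of the elements of a list (junk value `0` on `[]`). -/
def lcommList {R : Type} [NonUnitalNonAssocRing R] : List R → R
  | [] => 0
  | a :: l => lcomm a l

/-- The left-normed commutator of the variables listed in `c`. -/
def commOf {n : ℕ} (c : List (Fin n × G)) : FreeAlgebra F (Fin n × G) :=
  lcommList (c.map (FreeAlgebra.ι F))

/-- The subspace (of the free algebra) of the multidegree-`β` part of `B_n`: spanned by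
products `x_{i₁,h₁}⋯x_{i_r,h_r}·c₁⋯c_m` with all `h_j ≠ e`, each `c_j` a left-normed
commutator of length at least `2` in the variables, of total multidegree `β`. -/
def BUdeg (n : ℕ) (β : Fin n → ℕ) : Submodule F (FreeAlgebra F (Fin n × G)) :=
  Submodule.span F {x | ∃ (pre : List (Fin n × G)) (cs : List (List (Fin n × G))),
    (∀ p ∈ pre, p.2 ≠ (1 : G)) ∧ (∀ c ∈ cs, 2 ≤ c.length) ∧
    listDeg (pre ++ cs.flatten) = β ∧
    x = monOf F G pre * (cs.map (commOf F G)).prod}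

/-- The multidegree-`β` component `B_n^β` of `B_n` inside `R_n^G(W)`. -/
def BnDeg (grading : G → Submodule F W) (n : ℕ) (β : Fin n → ℕ) :
    Submodule F (FreeAlgebra F (Fin n × G) ⧸ IdU F G W grading n) :=
  Submodule.map (IdU F G W grading n).mkQ (BUdeg F G n β)

end Defs

section Commutators

variable {R : Type} [Ring R]

theorem lcomm_concat (a b : R) (l : List R) :
    lcomm a (l ++ [b]) = lcomm a l * b - b * lcomm a l := by
  induction l generalizing a with
  | nil => rfl
  | cons c l ih => exact ih _

theorem lcommList_concat {l : List R} (hl : l ≠ []) (b : R) :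
    lcommList (l ++ [b]) = lcommList l * b - b * lcommList l := by
  cases l with
  | nil => exact absurd rfl hl
  | cons a l => exact lcomm_concat a b l

end Commutators

section Degrees

variable {G : Type} {n : ℕ}

@[simp]
theorem listDeg_nil : listDeg ([] : List (Fin n × G)) = 0 := by
  ext i
  simp [listDeg]

@[simp]
theorem listDeg_append (l₁ l₂ : List (Fin n × G)) :
    listDeg (l₁ ++ l₂) = listDeg l₁ + listDeg l₂ := by
  ext i
  simp [listDeg]

theorem listDeg_cons (p : Fin n × G) (l : List (Fin n × G)) :
    listDeg (p :: l) = listDeg [p] + listDeg l :=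
  listDeg_append [p] l

theorem listDeg_singleton (p : Fin n × G) : listDeg [p] = Pi.single p.1 1 := by
  ext i
  simp only [listDeg, List.map_cons, List.map_nil, List.count_singleton, Pi.single_apply, beq_iff_eq]
  congr 1
  exact propext eq_comm

theorem sum_listDeg (l : List (Fin n × G)) : ∑ i, listDeg l i = l.length := by
  induction l with
  | nil => simp
  | cons p l ih =>
    rw [listDeg_cons, listDeg_singleton]
    simp [Finset.sum_add_distrib, ih, add_comm]

end Degrees

section Monomials

variable (F : Type) [Field F] {G : Type} {n : ℕ}

theorem commOf_concat {c : List (Fin n × G)} (hc : c ≠ []) (p : Fin n × G) :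
    commOf F G (c ++ [p]) =
      commOf F G c * FreeAlgebra.ι F p - FreeAlgebra.ι F p * commOf F G c := by
  simp only [commOf, List.map_append, List.map_cons, List.map_nil]
  exact lcommList_concat (by simpa using hc) _

theorem prod_map_commOf_singleton (l : List (Fin n × G)) :
    ((l.map fun p => [p]).map (commOf F G)).prod = monOf F G l := by
  rw [List.map_map]
  rfl

theorem flatten_map_singleton {X : Type} (l : List X) : (l.map fun p => [p]).flatten = l := by
  induction l with
  | nil => rfl
  | cons a l ih => simp [ih]

theorem monOf_mem_Adeg (l : List (Fin n × G)) : monOf F G l ∈ Adeg F G n (listDeg l) :=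
  Submodule.subset_span ⟨l, rfl, rfl⟩

theorem mul_mem_Adeg {β γ : Fin n → ℕ} {u v : FreeAlgebra F (Fin n × G)}
    (hu : u ∈ Adeg F G n β) (hv : v ∈ Adeg F G n γ) : u * v ∈ Adeg F G n (β + γ) := by
  have h := Submodule.mul_mem_mul hu hv
  rw [Adeg, Adeg, Submodule.span_mul_span] at h
  refine Submodule.span_mono ?_ h
  rintro _ ⟨_, ⟨l, rfl, rfl⟩, _, ⟨m, rfl, rfl⟩, rfl⟩
  exact ⟨l ++ m, by simp, by simp [monOf]⟩

theorem commOf_mem_Adeg (c : List (Fin n × G)) : commOf F G c ∈ Adeg F G n (listDeg c) := by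
  induction c using List.reverseRecOn with
  | nil => exact zero_mem _
  | append_singleton c p ih =>
    have hp : FreeAlgebra.ι F p ∈ Adeg F G n (listDeg [p]) := by
      simpa [monOf] using monOf_mem_Adeg F [p]
    rcases eq_or_ne c [] with rfl | hc
    · exact hp
    · rw [commOf_concat F hc, listDeg_append]
      refine sub_mem (mul_mem_Adeg F ih hp) ?_
      rw [add_comm]
      exact mul_mem_Adeg F hp ih

end Monomials

section GeneratedPieces

variable (F : Type) [Field F] {G : Type} [Group G] {n : ℕ}

/-- The lists whose left-normed commutator is a generator of the subalgebra attached to `S`: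
commutators of length at least `2`, variables of nontrivial degree, and the variables `x_{i,e}`
with `i ∈ S`. -/
def IsGenerator (S : Finset (Fin n)) (c : List (Fin n × G)) : Prop :=
  2 ≤ c.length ∨ ∃ p, c = [p] ∧ (p.2 ≠ 1 ∨ p.1 ∈ S)

theorem IsGenerator.ne_nil {S : Finset (Fin n)} {c : List (Fin n × G)} (h : IsGenerator S c) :
    c ≠ [] := by
  rintro rfl
  simp [IsGenerator] at h

theorem IsGenerator.concat {S : Finset (Fin n)} {c : List (Fin n × G)} (h : IsGenerator S c)
    (p : Fin n × G) : IsGenerator S (c ++ [p]) := by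
  have := List.length_pos_iff.2 h.ne_nil
  left
  simp only [List.length_append, List.length_singleton]
  omega

theorem IsGenerator.mono {S T : Finset (Fin n)} (hST : S ⊆ T) {c : List (Fin n × G)}
    (h : IsGenerator S c) : IsGenerator T c := by
  rcases h with h | ⟨p, rfl, h | h⟩
  · exact .inl h
  · exact .inr ⟨p, rfl, .inl h⟩
  · exact .inr ⟨p, rfl, .inr (hST h)⟩

variable (G) in
/-- The multidegree-`α` part of the subalgebra generated by the commutators of the lists
satisfying `IsGenerator S`. -/
def generatedDeg (S : Finset (Fin n)) (α : Fin n → ℕ) : Submodule F (FreeAlgebra F (Fin n × G)) :=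
  Submodule.span F {x | ∃ cs : List (List (Fin n × G)), (∀ c ∈ cs, IsGenerator S c) ∧
    listDeg cs.flatten = α ∧ x = (cs.map (commOf F G)).prod}

theorem prod_mem_generatedDeg {S : Finset (Fin n)} {cs : List (List (Fin n × G))}
    (h : ∀ c ∈ cs, IsGenerator S c) :
    (cs.map (commOf F G)).prod ∈ generatedDeg F G S (listDeg cs.flatten) :=
  Submodule.subset_span ⟨cs, h, rfl, rfl⟩

theorem commOf_mul_mem {S : Finset (Fin n)} {c : List (Fin n × G)} (hc : IsGenerator S c)
    {β : Fin n → ℕ} {u : FreeAlgebra F (Fin n × G)} (hu : u ∈ generatedDeg F G S β) :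
    commOf F G c * u ∈ generatedDeg F G S (listDeg c + β) := by
  suffices h : generatedDeg F G S β ≤
      (generatedDeg F G S (listDeg c + β)).comap (LinearMap.mulLeft F (commOf F G c)) from h hu
  refine Submodule.span_le.2 ?_
  rintro _ ⟨cs, hcs, rfl, rfl⟩
  refine Submodule.subset_span ⟨c :: cs, ?_, by simp, by simp⟩
  simpa using ⟨hc, hcs⟩

theorem mul_commOf_mem {S : Finset (Fin n)} {c : List (Fin n × G)} (hc : IsGenerator S c)
    {β : Fin n → ℕ} {u : FreeAlgebra F (Fin n × G)} (hu : u ∈ generatedDeg F G S β) :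
    u * commOf F G c ∈ generatedDeg F G S (β + listDeg c) := by
  suffices h : generatedDeg F G S β ≤
      (generatedDeg F G S (β + listDeg c)).comap (LinearMap.mulRight F (commOf F G c)) from h hu
  refine Submodule.span_le.2 ?_
  rintro _ ⟨cs, hcs, rfl, rfl⟩
  refine Submodule.subset_span ⟨cs ++ [c], ?_, by simp, by simp⟩
  simpa [or_imp, forall_and] using ⟨hcs, hc⟩

theorem mul_mem_generatedDeg {S : Finset (Fin n)} {β γ : Fin n → ℕ}
    {u v : FreeAlgebra F (Fin n × G)} (hu : u ∈ generatedDeg F G S β)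
    (hv : v ∈ generatedDeg F G S γ) : u * v ∈ generatedDeg F G S (β + γ) := by
  suffices h : generatedDeg F G S γ ≤
      (generatedDeg F G S (β + γ)).comap (LinearMap.mulLeft F u) from h hv
  clear hv v
  refine Submodule.span_le.2 ?_
  rintro _ ⟨cs, hcs, rfl, rfl⟩
  simp only [SetLike.mem_coe, Submodule.mem_comap, LinearMap.mulLeft_apply]
  induction cs generalizing u β with
  | nil => simpa using hu
  | cons c cs ih =>
    simp only [List.mem_cons, forall_eq_or_imp] at hcs
    simpa [mul_assoc, add_assoc] using ih (mul_commOf_mem F hcs.1 hu) hcs.2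

/-- The generated subalgebras are stable under commutators with arbitrary variables. -/
theorem commutator_ι_mem {S : Finset (Fin n)} {β : Fin n → ℕ}
    {u : FreeAlgebra F (Fin n × G)} (hu : u ∈ generatedDeg F G S β) (p : Fin n × G) :
    u * FreeAlgebra.ι F p - FreeAlgebra.ι F p * u ∈ generatedDeg F G S (listDeg [p] + β) := by
  suffices h : generatedDeg F G S β ≤ (generatedDeg F G S (listDeg [p] + β)).comap
      (LinearMap.mulRight F (FreeAlgebra.ι F p) - LinearMap.mulLeft F (FreeAlgebra.ι F p)) from h hu
  clear hu u
  refine Submodule.span_le.2 ?_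
  rintro _ ⟨cs, hcs, rfl, rfl⟩
  simp only [SetLike.mem_coe, Submodule.mem_comap, LinearMap.sub_apply, LinearMap.mulLeft_apply,
    LinearMap.mulRight_apply]
  induction cs with
  | nil => simp
  | cons c cs ih =>
    simp only [List.mem_cons, forall_eq_or_imp] at hcs
    have h₁ := commOf_mul_mem F hcs.1 (ih hcs.2)
    have h₂ := commOf_mul_mem F (hcs.1.concat p) (prod_mem_generatedDeg F hcs.2)
    rw [commOf_concat F hcs.1.ne_nil] at h₂
    simp only [List.map_cons, List.prod_cons, List.flatten_cons, listDeg_append] at h₁ h₂ ⊢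
    rw [show listDeg c + (listDeg [p] + listDeg cs.flatten) =
      listDeg [p] + (listDeg c + listDeg cs.flatten) by abel] at h₁
    rw [show listDeg c + listDeg [p] + listDeg cs.flatten =
      listDeg [p] + (listDeg c + listDeg cs.flatten) by abel] at h₂
    convert add_mem h₁ h₂ using 1
    noncomm_ring

variable (G) in
/-- The multidegree-`α` part of the span of `x_{i,e}^a u` with `u` in the subalgebra
attached to `S`. -/
def powMulDeg (S : Finset (Fin n)) (i : Fin n) (α : Fin n → ℕ) :
    Submodule F (FreeAlgebra F (Fin n × G)) :=
  ⨆ a ∈ Finset.range (α i + 1), (generatedDeg F G S (Function.update α i (α i - a))).map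
    (LinearMap.mulLeft F (FreeAlgebra.ι F (i, (1 : G))) ^ a)

theorem pow_mul_mem_powMulDeg {S : Finset (Fin n)} {i : Fin n} {β : Fin n → ℕ}
    {u : FreeAlgebra F (Fin n × G)} (hu : u ∈ generatedDeg F G S β) (a : ℕ) :
    FreeAlgebra.ι F (i, (1 : G)) ^ a * u ∈ powMulDeg F G S i (Pi.single i a + β) := by
  refine Submodule.mem_iSup_of_mem a (Submodule.mem_iSup_of_mem (by simp) ?_)
  refine ⟨u, ?_, by rw [LinearMap.pow_mulLeft, LinearMap.mulLeft_apply]⟩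
  rw [SetLike.mem_coe]
  convert hu using 2
  ext j
  by_cases h : j = i
  · subst h; simp
  · simp [h]

theorem powMulDeg_le {S : Finset (Fin n)} {i : Fin n} {α : Fin n → ℕ}
    {M : Submodule F (FreeAlgebra F (Fin n × G))}
    (h : ∀ a β u, Pi.single i a + β = α → u ∈ generatedDeg F G S β →
      FreeAlgebra.ι F (i, (1 : G)) ^ a * u ∈ M) : powMulDeg F G S i α ≤ M := by
  refine iSup₂_le fun a ha => ?_
  rintro _ ⟨u, hu, rfl⟩
  rw [LinearMap.pow_mulLeft, LinearMap.mulLeft_apply]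
  refine h a _ u ?_ hu
  rw [Finset.mem_range] at ha
  ext j
  by_cases h : j = i
  · subst h; simp; omega
  · simp [h]

theorem ι_mul_mem_powMulDeg {S : Finset (Fin n)} {i : Fin n} {β : Fin n → ℕ}
    {v : FreeAlgebra F (Fin n × G)} (hv : v ∈ powMulDeg F G S i β) :
    FreeAlgebra.ι F (i, (1 : G)) * v ∈ powMulDeg F G S i (Pi.single i 1 + β) := by
  suffices h : powMulDeg F G S i β ≤ (powMulDeg F G S i (Pi.single i 1 + β)).comap
      (LinearMap.mulLeft F (FreeAlgebra.ι F (i, (1 : G)))) from h hv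
  refine powMulDeg_le F ?_
  rintro a β u rfl hu
  have := pow_mul_mem_powMulDeg F (i := i) hu (a + 1)
  rwa [add_comm a 1, Pi.single_add, add_assoc, pow_add, pow_one, mul_assoc] at this

theorem mul_pow_mem_powMulDeg {S : Finset (Fin n)} {i : Fin n} {β : Fin n → ℕ}
    {u : FreeAlgebra F (Fin n × G)} (hu : u ∈ generatedDeg F G S β) (a : ℕ) :
    u * FreeAlgebra.ι F (i, (1 : G)) ^ a ∈ powMulDeg F G S i (Pi.single i a + β) := by
  induction a generalizing u β with
  | zero => simpa using pow_mul_mem_powMulDeg F (i := i) hu 0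
  | succ a ih =>
    have h₁ := ι_mul_mem_powMulDeg F (ih hu)
    have h₂ := ih (commutator_ι_mem F hu (i, 1))
    rw [← add_assoc, ← Pi.single_add, add_comm 1 a] at h₁
    rw [listDeg_singleton, ← add_assoc, ← Pi.single_add] at h₂
    convert add_mem h₁ h₂ using 1
    rw [pow_succ']
    noncomm_ring

theorem mul_mem_powMulDeg {S : Finset (Fin n)} {i : Fin n} {β γ : Fin n → ℕ}
    {u v : FreeAlgebra F (Fin n × G)} (hu : u ∈ generatedDeg F G S β)
    (hv : v ∈ powMulDeg F G S i γ) : u * v ∈ powMulDeg F G S i (β + γ) := by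
  suffices h : powMulDeg F G S i γ ≤
      (powMulDeg F G S i (β + γ)).comap (LinearMap.mulLeft F u) from h hv
  refine powMulDeg_le F ?_
  rintro a γ w rfl hw
  have key : powMulDeg F G S i (Pi.single i a + β) ≤
      (powMulDeg F G S i (β + (Pi.single i a + γ))).comap (LinearMap.mulRight F w) := by
    refine powMulDeg_le F ?_
    intro b δ t hδ ht
    have := pow_mul_mem_powMulDeg F (i := i) (mul_mem_generatedDeg F ht hw) b
    rw [← add_assoc, hδ, ← mul_assoc, add_comm (Pi.single i a) β, add_assoc] at this
    exact this
  have := key (mul_pow_mem_powMulDeg F (i := i) hu a)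
  simpa [mul_assoc] using this

theorem commOf_mem_generatedDeg {S : Finset (Fin n)} {c : List (Fin n × G)}
    (hc : IsGenerator S c) : commOf F G c ∈ generatedDeg F G S (listDeg c) := by
  simpa using prod_mem_generatedDeg F (cs := [c]) (by simpa using hc)

theorem one_mem_generatedDeg (S : Finset (Fin n)) :
    (1 : FreeAlgebra F (Fin n × G)) ∈ generatedDeg F G S 0 := by
  simpa using prod_mem_generatedDeg F (G := G) (S := S) (cs := []) (by simp)

theorem generatedDeg_mono {S T : Finset (Fin n)} (hST : S ⊆ T) (α : Fin n → ℕ) :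
    generatedDeg F G S α ≤ generatedDeg F G T α := by
  refine Submodule.span_mono ?_
  rintro _ ⟨cs, hcs, rfl, rfl⟩
  exact ⟨cs, fun c hc => (hcs c hc).mono hST, rfl, rfl⟩

theorem generatedDeg_insert (S : Finset (Fin n)) (i : Fin n) (α : Fin n → ℕ) :
    generatedDeg F G (insert i S) α = powMulDeg F G S i α := by
  apply le_antisymm
  · refine Submodule.span_le.2 ?_
    rintro _ ⟨cs, hcs, rfl, rfl⟩
    induction cs with
    | nil =>
      simpa using pow_mul_mem_powMulDeg F (i := i) (one_mem_generatedDeg F (G := G) S) 0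
    | cons c cs ih =>
      simp only [List.mem_cons, forall_eq_or_imp] at hcs
      have ih := ih hcs.2
      simp only [List.map_cons, List.prod_cons, List.flatten_cons, listDeg_append]
      have hgen (h : IsGenerator S c) :=
        mul_mem_powMulDeg F (i := i) (commOf_mem_generatedDeg F h) ih
      rcases hcs.1 with h | ⟨⟨j, g⟩, rfl, h⟩
      · exact hgen (.inl h)
      · by_cases hS : g ≠ 1 ∨ j ∈ S
        · exact hgen (.inr ⟨_, rfl, hS⟩)
        · simp only [not_or, not_not] at hS
          obtain ⟨rfl, hj⟩ := hS
          obtain rfl : j = i := by simpa [hj] using h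
          rw [listDeg_singleton]
          exact ι_mul_mem_powMulDeg F ih
  · refine powMulDeg_le F ?_
    rintro a β u rfl hu
    replace hu := generatedDeg_mono F (Finset.subset_insert i S) β hu
    induction a with
    | zero => simpa using hu
    | succ a ih =>
      have := commOf_mul_mem F (c := [(i, (1 : G))]) (.inr ⟨_, rfl, by simp⟩) ih
      rw [listDeg_singleton, ← add_assoc, ← Pi.single_add, add_comm 1 a] at this
      rwa [pow_succ', mul_assoc]

theorem generatedDeg_empty (α : Fin n → ℕ) : generatedDeg F G ∅ α = BUdeg F G n α := by
  apply le_antisymm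
  · refine Submodule.span_le.2 ?_
    rintro _ ⟨cs, hcs, rfl, rfl⟩
    induction cs with
    | nil => exact Submodule.subset_span ⟨[], [], by simp [monOf]⟩
    | cons c cs ih =>
      simp only [List.mem_cons, forall_eq_or_imp] at hcs
      suffices h : BUdeg F G n (listDeg cs.flatten) ≤
          (BUdeg F G n (listDeg (c :: cs).flatten)).comap (LinearMap.mulLeft F (commOf F G c)) by
        simpa using h (ih hcs.2)
      refine Submodule.span_le.2 ?_
      rintro _ ⟨pre, ds, hpre, hds, hdeg, rfl⟩
      simp only [SetLike.mem_coe, Submodule.mem_comap, LinearMap.mulLeft_apply,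
        List.flatten_cons, listDeg_append, ← hdeg]
      rcases hcs.1 with h | ⟨p, rfl, h⟩
      · clear hdeg hcs ih
        induction pre generalizing c with
        | nil =>
          refine Submodule.subset_span ⟨[], c :: ds, by simp, ?_, by simp, by simp [monOf]⟩
          simpa using ⟨h, hds⟩
        | cons p pre ihp =>
          simp only [List.mem_cons, forall_eq_or_imp] at hpre
          have hc : c ≠ [] := by rintro rfl; simp at h
          have h₁ := ihp c hpre.2 h
          have h₂ := ihp (c ++ [p]) hpre.2 (by simp; omega)
          have h₃ : BUdeg F G n (listDeg c + (listDeg pre + listDeg ds.flatten)) ≤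
              (BUdeg F G n (listDeg [p] + (listDeg c + (listDeg pre + listDeg ds.flatten)))).comap
                (LinearMap.mulLeft F (FreeAlgebra.ι F p)) := by
            refine Submodule.span_le.2 ?_
            rintro _ ⟨pre', ds', hpre', hds', hdeg', rfl⟩
            refine Submodule.subset_span ⟨p :: pre', ds', ?_, hds', ?_, ?_⟩
            · simpa using ⟨hpre.1, fun a b hab => hpre' (a, b) hab⟩
            · rw [List.cons_append, listDeg_cons, hdeg']
            · simp [monOf, mul_assoc]
          have h₄ := Submodule.mem_comap.1 (h₃ h₁)
          rw [commOf_concat F hc, listDeg_append] at h₂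
          rw [listDeg_cons]
          rw [show listDeg c + listDeg [p] + (listDeg pre + listDeg ds.flatten) =
            listDeg c + (listDeg [p] + listDeg pre + listDeg ds.flatten) by abel] at h₂
          rw [show listDeg [p] + (listDeg c + (listDeg pre + listDeg ds.flatten)) =
            listDeg c + (listDeg [p] + listDeg pre + listDeg ds.flatten) by abel] at h₄
          convert add_mem h₄ h₂ using 1
          simp only [monOf, List.map_cons, List.prod_cons, LinearMap.mulLeft_apply]
          noncomm_ring
      · have hp : p.2 ≠ 1 := by simpa using h
        refine Submodule.subset_span ⟨p :: pre, ds, ?_, hds, ?_, ?_⟩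
        · simpa using ⟨hp, fun a b hab => hpre (a, b) hab⟩
        · rw [List.cons_append, listDeg_cons, listDeg_append]
        · simp [monOf, commOf, lcommList, lcomm, mul_assoc]
  · refine Submodule.span_le.2 ?_
    rintro _ ⟨pre, cs, hpre, hcs, rfl, rfl⟩
    refine Submodule.subset_span ⟨(pre.map fun p => [p]) ++ cs, ?_, ?_, ?_⟩
    · intro c hc
      rcases List.mem_append.1 hc with hc | hc
      · obtain ⟨p, hp, rfl⟩ := List.mem_map.1 hc
        exact .inr ⟨p, rfl, .inl (hpre p hp)⟩
      · exact .inl (hcs c hc)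
    · rw [List.flatten_append, flatten_map_singleton]
    · rw [List.map_append, List.prod_append, prod_map_commOf_singleton]

theorem generatedDeg_le_Adeg (S : Finset (Fin n)) (α : Fin n → ℕ) :
    generatedDeg F G S α ≤ Adeg F G n α := by
  refine Submodule.span_le.2 ?_
  rintro _ ⟨cs, -, rfl, rfl⟩
  induction cs with
  | nil => simpa [monOf] using monOf_mem_Adeg F ([] : List (Fin n × G))
  | cons c cs ih => simpa using mul_mem_Adeg F (commOf_mem_Adeg F c) ih

theorem generatedDeg_univ (α : Fin n → ℕ) :
    generatedDeg F G Finset.univ α = Adeg F G n α := by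
  refine le_antisymm (generatedDeg_le_Adeg F _ α) (Submodule.span_le.2 ?_)
  rintro _ ⟨l, rfl, rfl⟩
  refine Submodule.subset_span ⟨l.map fun p => [p], ?_, ?_, ?_⟩
  · intro c hc
    obtain ⟨p, -, rfl⟩ := List.mem_map.1 hc
    exact .inr ⟨p, rfl, .inr (Finset.mem_univ _)⟩
  · rw [flatten_map_singleton]
  · rw [prod_map_commOf_singleton]

instance [Finite G] (α : Fin n → ℕ) : FiniteDimensional F (Adeg F G n α) := by
  refine FiniteDimensional.span_of_finite F ?_
  refine ((List.finite_length_eq (Fin n × G) (∑ i, α i)).image (monOf F G)).subset ?_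
  rintro _ ⟨l, rfl, rfl⟩
  exact ⟨l, (sum_listDeg l).symm, rfl⟩

instance [Finite G] (S : Finset (Fin n)) (α : Fin n → ℕ) :
    FiniteDimensional F (generatedDeg F G S α) :=
  Submodule.finiteDimensional_of_le (generatedDeg_le_Adeg F S α)

end GeneratedPieces

section Translation

open Polynomial

variable (F : Type) [Field F] {G : Type} [Group G] {n : ℕ}

open Classical in
variable (G) in
/-- The generic translation `x_{i,e} ↦ x_{i,e} + X`, fixing all other variables. -/
noncomputable def translateAt (i : Fin n) :
    FreeAlgebra F (Fin n × G) →ₐ[F] (FreeAlgebra F (Fin n × G))[X] :=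
  FreeAlgebra.lift F fun p => C (FreeAlgebra.ι F p) + if p = (i, 1) then X else 0

open Classical in
theorem translateAt_ι (i : Fin n) (p : Fin n × G) :
    translateAt F G i (FreeAlgebra.ι F p) =
      C (FreeAlgebra.ι F p) + if p = (i, 1) then X else 0 :=
  FreeAlgebra.lift_ι_apply _ _

theorem coeff_zero_translateAt (i : Fin n) (f : FreeAlgebra F (Fin n × G)) :
    (translateAt F G i f).coeff 0 = f := by
  induction f using FreeAlgebra.induction with
  | grade0 r => simp [AlgHom.commutes, Polynomial.algebraMap_apply]
  | grade1 p => rw [translateAt_ι]; split_ifs <;> simp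
  | mul a b ha hb => rw [map_mul, mul_coeff_zero, ha, hb]
  | add a b ha hb => rw [map_add, coeff_add, ha, hb]

theorem translateAt_commutator (i : Fin n) (p : Fin n × G)
    {u : FreeAlgebra F (Fin n × G)} {P : (FreeAlgebra F (Fin n × G))[X]}
    (hP : P = 0 ∨ P = X) (hu : translateAt F G i u = C u + P) :
    translateAt F G i (u * FreeAlgebra.ι F p - FreeAlgebra.ι F p * u) =
      C (u * FreeAlgebra.ι F p - FreeAlgebra.ι F p * u) := by
  have hX (w : (FreeAlgebra F (Fin n × G))[X]) : w * X = X * w := (X_mul (p := w)).symm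
  rw [map_sub, map_mul, map_mul, translateAt_ι, hu, map_sub, map_mul, map_mul]
  split_ifs <;> rcases hP with rfl | rfl <;> simp only [mul_add, add_mul, hX, add_zero] <;> abel

theorem translateAt_commOf (i : Fin n) {c : List (Fin n × G)} (hc : 2 ≤ c.length) :
    translateAt F G i (commOf F G c) = C (commOf F G c) := by
  induction c using List.reverseRecOn with
  | nil => simp at hc
  | append_singleton c p ih =>
    have hne : c ≠ [] := by rintro rfl; simp at hc
    rw [commOf_concat F hne]
    by_cases h : 2 ≤ c.length
    · exact translateAt_commutator F i p (.inl rfl) (by rw [ih h, add_zero])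
    · obtain ⟨q, rfl⟩ : ∃ q, c = [q] := by
        rw [← List.length_eq_one_iff]
        simp only [List.length_append, List.length_singleton] at hc
        omega
      refine translateAt_commutator F i p ?_ (translateAt_ι F i q)
      split_ifs <;> simp

theorem translateAt_generatedDeg {S : Finset (Fin n)} {i : Fin n} (hi : i ∉ S) {α : Fin n → ℕ}
    {u : FreeAlgebra F (Fin n × G)} (hu : u ∈ generatedDeg F G S α) :
    translateAt F G i u = C u := by
  induction hu using Submodule.span_induction with
  | zero => simp
  | add a b _ _ ha hb => rw [map_add, map_add, ha, hb]
  | smul r a _ ha => rw [map_smul, ha, smul_C]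
  | mem u hu =>
    obtain ⟨cs, hcs, -, rfl⟩ := hu
    rw [map_list_prod, map_list_prod, List.map_map, List.map_map]
    congr 1
    refine List.map_congr_left fun c hc => ?_
    rcases hcs c hc with h | ⟨p, rfl, h⟩
    · exact translateAt_commOf F i h
    · refine (translateAt_ι F i p).trans ?_
      rw [if_neg, add_zero]
      · rfl
      · rintro rfl
        simp [hi] at h

variable (G) in
/-- The formal partial derivative with respect to `x_{i,e}`. -/
noncomputable def derivAt (i : Fin n) :
    FreeAlgebra F (Fin n × G) →ₗ[F] FreeAlgebra F (Fin n × G) where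
  toFun f := (translateAt F G i f).coeff 1
  map_add' a b := by simp
  map_smul' r a := by simp

theorem derivAt_ι_mul (i : Fin n) (f : FreeAlgebra F (Fin n × G)) :
    derivAt F G i (FreeAlgebra.ι F (i, 1) * f) =
      FreeAlgebra.ι F (i, 1) * derivAt F G i f + f := by
  simp [derivAt, translateAt_ι, add_mul, coeff_zero_translateAt]

theorem derivAt_generatedDeg {S : Finset (Fin n)} {i : Fin n} (hi : i ∉ S) {α : Fin n → ℕ}
    {u : FreeAlgebra F (Fin n × G)} (hu : u ∈ generatedDeg F G S α) :
    derivAt F G i u = 0 := by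
  simp [derivAt, translateAt_generatedDeg F hi hu]

/-- Coefficients in a vector space of a polynomial function vanishing on an infinite field
are zero. -/
theorem coeff_eq_zero_of_forall_sum_smul_eq_zero {K V : Type} [Field K] [Infinite K]
    [AddCommGroup V] [Module K V] {s : Finset ℕ} {w : ℕ → V}
    (h : ∀ t : K, ∑ k ∈ s, t ^ k • w k = 0) {k : ℕ} (hk : k ∈ s) : w k = 0 := by
  rw [← Module.forall_dual_apply_eq_zero_iff K]
  intro φ
  have hp : (∑ j ∈ s, monomial j (φ (w j)) : K[X]) = 0 := by
    refine Polynomial.funext fun t => ?_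
    have := congrArg φ (h t)
    simpa [eval_finsetSum, mul_comm] using this
  have := congrArg (fun p => coeff p k) hp
  simpa [finsetSum_coeff, coeff_monomial, hk] using this

end Translation

section Identities

open Polynomial

variable {F G W : Type} [Field F] [Ring W] [Algebra F W] {n : ℕ}

theorem mem_IdU {grading : G → Submodule F W} {f : FreeAlgebra F (Fin n × G)} :
    f ∈ IdU F G W grading n ↔
      ∀ a : Fin n × G → W, (∀ p, a p ∈ grading p.2) → FreeAlgebra.lift F a f = 0 := by
  simp [IdU]

theorem IdU_le_comap_mulLeft (grading : G → Submodule F W) (u : FreeAlgebra F (Fin n × G)) :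
    IdU F G W grading n ≤ (IdU F G W grading n).comap (LinearMap.mulLeft F u) := by
  intro f hf
  rw [Submodule.mem_comap, mem_IdU]
  intro a ha
  rw [LinearMap.mulLeft_apply, map_mul, mem_IdU.1 hf a ha, mul_zero]

theorem IdU_le_comap_derivAt [Group G] [Infinite F] (grading : G → Submodule F W)
    (hone : (1 : W) ∈ grading 1) (i : Fin n) :
    IdU F G W grading n ≤ (IdU F G W grading n).comap (derivAt F G i) := by
  classical
  intro f hf
  rw [Submodule.mem_comap, mem_IdU]
  intro a ha
  set P := translateAt F G i f with hP
  by_cases h1 : 1 ∈ P.support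
  swap
  · rw [notMem_support_iff] at h1
    simp [derivAt, ← hP, h1]
  refine coeff_eq_zero_of_forall_sum_smul_eq_zero (K := F)
    (w := fun k => FreeAlgebra.lift F a (P.coeff k)) (s := P.support) (fun t => ?_) h1
  let Ψ : (FreeAlgebra F (Fin n × G))[X] →ₐ[F] W :=
    eval₂AlgHom (FreeAlgebra.lift F a) (algebraMap F W t)
      fun b => (Algebra.commutes t (FreeAlgebra.lift F a b)).symm
  have hΨ (Q : (FreeAlgebra F (Fin n × G))[X]) : Ψ Q =
      Q.eval₂ (FreeAlgebra.lift F a : FreeAlgebra F (Fin n × G) →+* W) (algebraMap F W t) := rfl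
  let a' : Fin n × G → W := fun p => a p + if p = (i, 1) then algebraMap F W t else 0
  have hcomp : Ψ.comp (translateAt F G i) = FreeAlgebra.lift F a' := by
    ext p
    simp only [Function.comp_apply, AlgHom.coe_comp, translateAt_ι, FreeAlgebra.lift_ι_apply, a']
    split_ifs <;> simp [hΨ]
  have ha' : ∀ p, a' p ∈ grading p.2 := by
    intro p
    refine add_mem (ha p) ?_
    split_ifs with hp
    · subst hp
      rw [Algebra.algebraMap_eq_smul_one]
      exact Submodule.smul_mem _ _ hone
    · exact zero_mem _
  have h0 : Ψ P = 0 := by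
    rw [← mem_IdU.1 hf a' ha', ← hcomp]
    rfl
  rw [← h0]
  rw [hΨ, eval₂_eq_sum, Polynomial.sum]
  refine Finset.sum_congr rfl fun k _ => ?_
  rw [← map_pow, ← Algebra.commutes, Algebra.smul_def]
  rfl

end Identities

section WeylPair

variable {K V : Type} [Field K] [CharZero K] [AddCommGroup V] [Module K V]

theorem weyl_pow_succ_apply {X D : Module.End K V} (hXD : ∀ v, D (X v) = X (D v) + v)
    {v : V} (hv : D v = 0) (a : ℕ) : D ((X ^ (a + 1)) v) = (a + 1 : K) • (X ^ a) v := by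
  induction a with
  | zero => simp [hXD, hv]
  | succ a ih =>
    rw [pow_succ' X (a + 1), Module.End.mul_apply, hXD, ih, map_smul, ← Module.End.mul_apply,
      ← pow_succ']
    push_cast
    module

theorem weyl_pow_apply_self {X D : Module.End K V} (hXD : ∀ v, D (X v) = X (D v) + v)
    {v : V} (hv : D v = 0) (a : ℕ) : (D ^ a) ((X ^ a) v) = (a.factorial : K) • v := by
  induction a with
  | zero => simp
  | succ a ih =>
    rw [pow_succ D, Module.End.mul_apply, weyl_pow_succ_apply hXD hv, map_smul, ih, smul_smul,
      Nat.factorial_succ]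
    push_cast
    rfl

/-- If `D X = X D + 1` and `D` kills all the `K_a`, the sum of the spaces `X^a K_a` is direct
and `X^a` is injective on `K_a`. -/
theorem finrank_iSup_map_pow {X D : Module.End K V} (hXD : ∀ v, D (X v) = X (D v) + v)
    (N : ℕ → Submodule K V) [∀ a, FiniteDimensional K (N a)] (hN : ∀ a, ∀ v ∈ N a, D v = 0)
    (m : ℕ) :
    Module.finrank K ↥(⨆ a ∈ Finset.range m, (N a).map (X ^ a)) =
      ∑ a ∈ Finset.range m, Module.finrank K (N a) := by
  induction m with
  | zero =>
    have : ⨆ a ∈ Finset.range 0, (N a).map (X ^ a) = ⊥ := by simp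
    rw [this, finrank_bot, Finset.sum_range_zero]
  | succ m ih =>
    have hinj : ∀ v ∈ N m, (D ^ m) ((X ^ m) v) = 0 → v = 0 := by
      intro v hv h
      rw [weyl_pow_apply_self hXD (hN m v hv)] at h
      exact (smul_eq_zero.1 h).resolve_left (Nat.cast_ne_zero.2 m.factorial_ne_zero)
    have hker : ⨆ a ∈ Finset.range m, (N a).map (X ^ a) ≤ LinearMap.ker (D ^ m) := by
      refine iSup₂_le fun a ha => ?_
      rintro _ ⟨v, hv, rfl⟩
      obtain ⟨b, rfl⟩ := Nat.exists_eq_add_of_lt (Finset.mem_range.1 ha)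
      rw [LinearMap.mem_ker, show a + b + 1 = b + 1 + a by ring, pow_add D, Module.End.mul_apply,
        weyl_pow_apply_self hXD (hN a v hv), map_smul, pow_succ, Module.End.mul_apply, hN a v hv,
        map_zero, smul_zero]
    have hdisj : (N m).map (X ^ m) ⊓ ⨆ a ∈ Finset.range m, (N a).map (X ^ a) = ⊥ := by
      rw [eq_bot_iff]
      rintro _ ⟨⟨v, hv, rfl⟩, h⟩
      simp [hinj v hv (hker h)]
    have hmap : Module.finrank K ((N m).map (X ^ m)) = Module.finrank K (N m) := by
      refine (LinearEquiv.finrank_eq (LinearEquiv.ofBijective ((X ^ m).submoduleMap (N m))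
        ⟨?_, LinearMap.submoduleMap_surjective _ _⟩)).symm
      rw [← LinearMap.ker_eq_bot, LinearMap.ker_eq_bot']
      intro v hv
      have : (X ^ m) v = 0 := congrArg Subtype.val hv
      exact Subtype.ext (hinj v v.2 (by rw [this, map_zero]))
    have : FiniteDimensional K ↥(⨆ a ∈ Finset.range m, (N a).map (X ^ a)) := by
      rw [← Finset.sup_eq_iSup]
      infer_instance
    have := Submodule.finrank_sup_add_finrank_inf_eq ((N m).map (X ^ m))
      (⨆ a ∈ Finset.range m, (N a).map (X ^ a))
    rw [hdisj, finrank_bot, add_zero, hmap, ih] at this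
    rw [Finset.range_add_one, Finset.iSup_insert, this, Finset.sum_insert Finset.notMem_range_self]

end WeylPair

section Dimensions

variable {F G W : Type} [Field F] [CharZero F] [Group G] [Finite G] [Ring W] [Algebra F W] {n : ℕ}

theorem finrank_map_generatedDeg_insert (grading : G → Submodule F W)
    (hone : (1 : W) ∈ grading 1) {S : Finset (Fin n)} {i : Fin n} (hi : i ∉ S) (α : Fin n → ℕ) :
    Module.finrank F ↥((generatedDeg F G (insert i S) α).map (IdU F G W grading n).mkQ) =
      ∑ b ∈ Finset.range (α i + 1), Module.finrank F
        ↥((generatedDeg F G S (Function.update α i b)).map (IdU F G W grading n).mkQ) := by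
  set I := IdU F G W grading n with hI
  let x : Module.End F (FreeAlgebra F (Fin n × G)) :=
    LinearMap.mulLeft F (FreeAlgebra.ι F (i, (1 : G)))
  let X : Module.End F (FreeAlgebra F (Fin n × G) ⧸ I) :=
    I.mapQ I x (IdU_le_comap_mulLeft grading _)
  let D : Module.End F (FreeAlgebra F (Fin n × G) ⧸ I) :=
    I.mapQ I (derivAt F G i) (IdU_le_comap_derivAt grading hone i)
  have hXD : ∀ v, D (X v) = X (D v) + v := by
    intro v
    obtain ⟨f, rfl⟩ := I.mkQ_surjective v
    simp only [X, D, x, Submodule.mkQ_apply, Submodule.mapQ_apply, LinearMap.mulLeft_apply,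
      derivAt_ι_mul, Submodule.Quotient.mk_add]
  have hX (a : ℕ) : I.mkQ ∘ₗ (x ^ a) = (X ^ a) ∘ₗ I.mkQ := by
    induction a with
    | zero => rfl
    | succ a ih =>
      ext f
      have h := LinearMap.congr_fun ih f
      simp only [LinearMap.comp_apply] at h
      rw [LinearMap.comp_apply, LinearMap.comp_apply, pow_succ', pow_succ', Module.End.mul_apply,
        Module.End.mul_apply, ← h]
      rfl
  let N : ℕ → Submodule F (FreeAlgebra F (Fin n × G) ⧸ I) := fun a =>
    (generatedDeg F G S (Function.update α i (α i - a))).map I.mkQ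
  have hN : ∀ a, ∀ v ∈ N a, D v = 0 := by
    rintro a _ ⟨u, hu, rfl⟩
    simp only [D, Submodule.mkQ_apply, Submodule.mapQ_apply, derivAt_generatedDeg F hi hu,
      Submodule.Quotient.mk_zero]
  have hsup : (generatedDeg F G (insert i S) α).map I.mkQ =
      ⨆ a ∈ Finset.range (α i + 1), (N a).map (X ^ a) := by
    rw [generatedDeg_insert, powMulDeg]
    simp only [Submodule.map_iSup, N, ← Submodule.map_comp, ← hX]
    rfl
  have hfin (a : ℕ) : FiniteDimensional F (N a) := inferInstanceAs
    (FiniteDimensional F ((generatedDeg F G S (Function.update α i (α i - a))).map I.mkQ))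
  rw [hsup, finrank_iSup_map_pow hXD N hN]
  exact Finset.sum_flip fun b =>
    Module.finrank F ↥((generatedDeg F G S (Function.update α i b)).map I.mkQ)

theorem finrank_map_generatedDeg (grading : G → Submodule F W)
    (hone : (1 : W) ∈ grading 1) (S : Finset (Fin n)) (α : Fin n → ℕ) :
    Module.finrank F ↥((generatedDeg F G S α).map (IdU F G W grading n).mkQ) =
      ∑ β ∈ Fintype.piFinset (fun j => if j ∈ S then Finset.range (α j + 1) else {α j}),
        Module.finrank F ↥(BnDeg F G W grading n β) := by
  induction S using Finset.induction_on generalizing α with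
  | empty =>
    simp only [Finset.notMem_empty, if_false, Fintype.piFinset_singleton, Finset.sum_singleton]
    rw [generatedDeg_empty]
    rfl
  | insert i S hi ih =>
    rw [finrank_map_generatedDeg_insert grading hone hi]
    simp only [ih]
    rw [← Finset.sum_fiberwise_of_maps_to (g := fun β : Fin n → ℕ => β i)
      (t := Finset.range (α i + 1))]
    · refine Finset.sum_congr rfl fun b hb => Finset.sum_congr ?_ fun _ _ => rfl
      ext β
      simp only [Fintype.mem_piFinset, Finset.mem_filter]
      constructor
      · intro h
        have hb' : β i = b := by simpa [hi] using h i
        refine ⟨fun j => ?_, hb'⟩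
        rcases eq_or_ne j i with rfl | hj
        · simpa [hb'] using hb
        · simpa [hj] using h j
      · rintro ⟨h, hb'⟩ j
        rcases eq_or_ne j i with rfl | hj
        · simp [hi, hb']
        · simpa [hj] using h j
    · intro β hβ
      simpa using Fintype.mem_piFinset.1 hβ i

end Dimensions

theorem stmt11 {F G W : Type} [Field F] [IsAlgClosed F] [CharZero F]
    [Group G] [Finite G] [DecidableEq G]
    [Ring W] [Algebra F W]
    (grading : G → Submodule F W)
    (hdecomp : DirectSum.IsInternal grading)
    (hgmul : ∀ (g h : G), ∀ a ∈ grading g, ∀ b ∈ grading h, a * b ∈ grading (g * h))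
    (hone : (1 : W) ∈ grading 1)
    (haffine : ∃ S : Finset W, Algebra.adjoin F (S : Set W) = ⊤)
    (hPI : SatisfiesOrdinaryPI F W)
    (n : ℕ) (α : Fin n → ℕ) :
    Module.finrank F ↥(RnDeg F G W grading n α) =
      ∑ β ∈ Fintype.piFinset (fun i => Finset.range (α i + 1)),
        Module.finrank F ↥(BnDeg F G W grading n β) := by
  have h := finrank_map_generatedDeg grading hone Finset.univ α
  rw [generatedDeg_univ] at h
  simp only [Finset.mem_univ, if_true] at h
  exact h
end

section
/- Let F be an algebraically closed field of characteristic zero, G a finite group with identity e, and W a unitary affine G-graded F-algebra satisfying a nontrivial ordinary polynomial identity. Fix n, t, and p ≤ t, and set M_q = Σ_{s=q}^{t} R_{n,e}^{(t−s)}·B_n^{(s)} for q ≤ t (and M_{t+1} = 0). Let {f₁,…,f_k} be a basis of B_n^{(p)} consisting of e-multihomogeneous elements. Then the images in M_p/M_{p+1} of the elements x_{1,e}^{α₁}⋯x_{n,e}^{α_n}·f_j, as α ranges over ℕ^n with α₁+⋯+α_n = t−p and j over {1,…,k}, form an F-vector space basis of M_p/M_{p+1}. -/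
open Filter

noncomputable section Defs

variable (F : Type) [Field F] (G : Type) [Group G] (W : Type) [Ring W] [Algebra F W]

/-- The span of the monomials of total degree `t` in the free algebra. -/
def AdegTot (n t : ℕ) : Submodule F (FreeAlgebra F (Fin n × G)) :=
  Submodule.span F {x | ∃ l : List (Fin n × G), l.length = t ∧ x = monOf F G l}

/-- The total-degree-`s` part `B_n^{(s)}` of `B_n`, inside the free algebra. -/
def BUtot (n s : ℕ) : Submodule F (FreeAlgebra F (Fin n × G)) :=
  Submodule.span F {x | ∃ (pre : List (Fin n × G)) (cs : List (List (Fin n × G))),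
    (∀ p ∈ pre, p.2 ≠ (1 : G)) ∧ (∀ c ∈ cs, 2 ≤ c.length) ∧
    (pre ++ cs.flatten).length = s ∧
    x = monOf F G pre * (cs.map (commOf F G)).prod}

/-- The span of the degree-`d` monomials in the identity-component variables
`x_{1,e}, …, x_{n,e}` (so `R_{n,e}^{(d)}` upstairs in the free algebra). -/
def ReDeg (n d : ℕ) : Submodule F (FreeAlgebra F (Fin n × G)) :=
  Submodule.span F {x | ∃ l : List (Fin n × G),
    (∀ p ∈ l, p.2 = (1 : G)) ∧ l.length = d ∧ x = monOf F G l}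

/-- `M_q` (upstairs in the free algebra): `Σ_{s=q}^{t} R_{n,e}^{(t−s)}·B_n^{(s)}`. -/
def MU (n t q : ℕ) : Submodule F (FreeAlgebra F (Fin n × G)) :=
  ∑ s ∈ Finset.Icc q t, ReDeg F G n (t - s) * BUtot F G n s

/-- The subspace of `e`-multihomogeneous elements of degree `γ` in the free algebra:
the span of the monomials containing exactly `γ i` occurrences of `x_{i,e}` for each `i`. -/
def EHom (n : ℕ) [DecidableEq G] (γ : Fin n → ℕ) : Submodule F (FreeAlgebra F (Fin n × G)) :=
  Submodule.span F {x | ∃ l : List (Fin n × G),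
    (∀ i : Fin n, l.count (i, (1 : G)) = γ i) ∧ x = monOf F G l}

/-- The monomial `x_{1,e}^{α₁} ⋯ x_{n,e}^{α_n}`. -/
def eMon (n : ℕ) (α : Fin n → ℕ) : FreeAlgebra F (Fin n × G) :=
  monOf F G ((List.finRange n).flatMap fun i => List.replicate (α i) (i, (1 : G)))

end Defs

section Shift

open Polynomial

variable {F : Type} [Field F]

/-- The substitution `x ↦ x + c x · X` into polynomials over the free algebra. -/
noncomputable def shiftHom {V : Type} (c : V → F) :
    FreeAlgebra F V →ₐ[F] Polynomial (FreeAlgebra F V) :=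
  FreeAlgebra.lift F fun v => C (FreeAlgebra.ι F v) + C (algebraMap F (FreeAlgebra F V) (c v)) * X

lemma shiftHom_ι {V : Type} (c : V → F) (v : V) :
    shiftHom c (FreeAlgebra.ι F v) =
      C (FreeAlgebra.ι F v) + C (algebraMap F (FreeAlgebra F V) (c v)) * X := by
  simp [shiftHom]

lemma shiftHom_ι_of_eq_zero {V : Type} {c : V → F} {v : V} (h : c v = 0) :
    shiftHom c (FreeAlgebra.ι F v) = C (FreeAlgebra.ι F v) := by
  simp [shiftHom_ι, h]

lemma commute_C_algebraMap_mul_X {A : Type} [Ring A] [Algebra F A] (r : F) (P : Polynomial A) :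
    Commute (C (algebraMap F A r) * X) P := by
  have h : Commute (algebraMap F (Polynomial A) r) P := Algebra.commutes r P
  rw [Polynomial.algebraMap_apply] at h
  exact h.mul_left (Polynomial.commute_X P)

lemma shiftHom_commutator {V : Type} (c : V → F) (v w : V) :
    shiftHom c (FreeAlgebra.ι F v * FreeAlgebra.ι F w - FreeAlgebra.ι F w * FreeAlgebra.ι F v) =
      C (FreeAlgebra.ι F v * FreeAlgebra.ι F w - FreeAlgebra.ι F w * FreeAlgebra.ι F v) := by
  have h₁ := (commute_C_algebraMap_mul_X (c v) (C (FreeAlgebra.ι F w))).eq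
  have h₂ := (commute_C_algebraMap_mul_X (c w) (C (FreeAlgebra.ι F v))).eq
  have h₃ := (commute_C_algebraMap_mul_X (A := FreeAlgebra F V) (c v)
    (C (algebraMap F (FreeAlgebra F V) (c w)) * X)).eq
  simp only [map_sub, map_mul, shiftHom_ι, mul_add, add_mul, h₁, h₂, h₃]
  abel

lemma shiftHom_lcomm {V : Type} (c : V → F) (l : List V) :
    ∀ a : FreeAlgebra F V, shiftHom c a = C a →
      shiftHom c (lcomm a (l.map (FreeAlgebra.ι F))) = C (lcomm a (l.map (FreeAlgebra.ι F))) := by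
  induction l with
  | nil => intro a h; simpa [lcomm] using h
  | cons v l ih =>
    intro a h
    simp only [List.map_cons, lcomm]
    refine ih _ ?_
    have h₁ := (commute_C_algebraMap_mul_X (c v) (C a)).eq
    simp only [map_sub, map_mul, shiftHom_ι, mul_add, add_mul, h, h₁]
    abel

variable {G : Type} {n : ℕ}

lemma shiftHom_commOf (c : Fin n × G → F) {l : List (Fin n × G)} (hl : 2 ≤ l.length) :
    shiftHom c (commOf F G l) = C (commOf F G l) := by
  match l, hl with
  | v :: w :: l, _ =>
    simp only [commOf, lcommList, List.map_cons, lcomm]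
    exact shiftHom_lcomm c l _ (shiftHom_commutator c v w)

lemma shiftHom_eq_C_of_mem_BUtot [Group G] {c : Fin n × G → F} (hc : ∀ v, v.2 ≠ 1 → c v = 0)
    {s : ℕ} {b : FreeAlgebra F (Fin n × G)} (hb : b ∈ BUtot F G n s) : shiftHom c b = C b := by
  refine Submodule.span_induction (p := fun x _ => shiftHom c x = C x) ?_ (by simp)
    (fun x y _ _ hx hy => by simp [hx, hy]) ?_ hb
  · rintro x ⟨pre, cs, hpre, hcs, -, rfl⟩
    have h₁ : shiftHom c (monOf F G pre) = C (monOf F G pre) := by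
      clear hcs
      induction pre with
      | nil => simp [monOf]
      | cons v l ih =>
        have h := ih fun p hp => hpre p (List.mem_cons_of_mem _ hp)
        simp only [monOf, List.map_cons, List.prod_cons, map_mul] at h ⊢
        rw [h, shiftHom_ι_of_eq_zero (hc v (hpre v List.mem_cons_self))]
    have h₂ : shiftHom c (cs.map (commOf F G)).prod = C (cs.map (commOf F G)).prod := by
      clear h₁ hpre
      induction cs with
      | nil => simp
      | cons v l ih =>
        have h := ih fun p hp => hcs p (List.mem_cons_of_mem _ hp)
        simp only [List.map_cons, List.prod_cons, map_mul] at h ⊢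
        rw [h, shiftHom_commOf c (hcs v List.mem_cons_self)]
    rw [map_mul, h₁, h₂, C_mul]
  · intro r x _ hx
    rw [map_smul, hx, Polynomial.smul_C]

lemma natDegree_shiftHom_ι_le {V : Type} (c : V → F) (v : V) :
    (shiftHom c (FreeAlgebra.ι F v)).natDegree ≤ 1 := by
  rw [shiftHom_ι]
  compute_degree

lemma natDegree_shiftHom_monOf_le (c : Fin n × G → F) (l : List (Fin n × G)) :
    (shiftHom c (monOf F G l)).natDegree ≤ l.length := by
  induction l with
  | nil => simp [monOf]
  | cons v l ih =>
    have : monOf F G (v :: l) = FreeAlgebra.ι F v * monOf F G l := by simp [monOf]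
    rw [this, map_mul, List.length_cons, add_comm]
    exact natDegree_mul_le_of_le (natDegree_shiftHom_ι_le c v) ih

lemma coeff_shiftHom_monOf (c : Fin n × G → F) (l : List (Fin n × G)) :
    (shiftHom c (monOf F G l)).coeff l.length = algebraMap F _ (l.map c).prod := by
  induction l with
  | nil => simp [monOf]
  | cons v l ih =>
    have : monOf F G (v :: l) = FreeAlgebra.ι F v * monOf F G l := by simp [monOf]
    rw [this, map_mul, List.length_cons, add_comm, coeff_mul_add_eq_of_natDegree_le
      (natDegree_shiftHom_ι_le c v) (natDegree_shiftHom_monOf_le c l), ih, shiftHom_ι]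
    simp [coeff_C]

variable {W : Type} [Ring W] [Algebra F W] {grading : G → Submodule F W}

lemma mem_IdU_iff {f : FreeAlgebra F (Fin n × G)} : f ∈ IdU F G W grading n ↔
    ∀ a : Fin n × G → W, (∀ v, a v ∈ grading v.2) → FreeAlgebra.lift F a f = 0 := by
  simp [IdU]

lemma mul_mem_IdU (r : FreeAlgebra F (Fin n × G)) {f : FreeAlgebra F (Fin n × G)}
    (hf : f ∈ IdU F G W grading n) : r * f ∈ IdU F G W grading n := by
  rw [mem_IdU_iff] at hf ⊢
  intro a ha
  rw [map_mul, hf a ha, mul_zero]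

lemma eval₂_shiftHom {V : Type} (c : V → F) (a : V → W) (s : F) (f : FreeAlgebra F V) :
    (shiftHom c f).eval₂ (FreeAlgebra.lift F a : FreeAlgebra F V →+* W) (algebraMap F W s) =
      FreeAlgebra.lift F (fun v => a v + algebraMap F W (c v * s)) f := by
  have hcomm : ∀ x, Commute ((FreeAlgebra.lift F a : FreeAlgebra F V →+* W) x)
      (algebraMap F W s) := fun x => (Algebra.commutes s _).symm
  change ((eval₂RingHom' _ _ hcomm).comp (shiftHom c : FreeAlgebra F V →+* _)) f = _
  induction f using FreeAlgebra.induction with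
  | grade0 r =>
    simp [Polynomial.algebraMap_apply]
  | grade1 v =>
    have h : (FreeAlgebra.lift F a : FreeAlgebra F V →+* W) (FreeAlgebra.ι F v) = a v := by simp
    simp only [RingHom.comp_apply, RingHom.coe_coe, shiftHom_ι, map_add, map_mul]
    simp [eval₂RingHom']
  | mul x y hx hy => rw [map_mul, map_mul, hx, hy]
  | add x y hx hy => rw [map_add, map_add, hx, hy]

lemma coeff_shiftHom_mem_IdU [CharZero F] [Group G] (hone : (1 : W) ∈ grading 1)
    {c : Fin n × G → F} (hc : ∀ v, v.2 ≠ 1 → c v = 0) {f : FreeAlgebra F (Fin n × G)}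
    (hf : f ∈ IdU F G W grading n) (k : ℕ) : (shiftHom c f).coeff k ∈ IdU F G W grading n := by
  rw [mem_IdU_iff] at hf ⊢
  intro a ha
  rw [← Module.forall_dual_apply_eq_zero_iff F]
  intro ℓ
  set P := shiftHom c f with hP
  let Q : Polynomial F := ∑ i ∈ Finset.range (P.natDegree + 1),
    monomial i (ℓ (FreeAlgebra.lift F a (P.coeff i)))
  have hQ : Q = 0 := by
    refine Polynomial.funext fun s => ?_
    have h := eval₂_shiftHom c a s f
    rw [hf, ← hP, eval₂_eq_sum_range] at h
    · have h' := congrArg ℓ h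
      rw [map_sum, map_zero] at h'
      rw [eval_zero, ← h', eval_finsetSum]
      refine Finset.sum_congr rfl fun i _ => ?_
      rw [← map_pow, ← Algebra.commutes, ← Algebra.smul_def, map_smul, eval_monomial, smul_eq_mul,
        mul_comm]
      rfl
    · intro v
      refine add_mem (ha v) ?_
      by_cases hv : v.2 = 1
      · rw [hv, Algebra.algebraMap_eq_smul_one]
        exact Submodule.smul_mem _ _ hone
      · simp [hc v hv]
  by_cases hk : k ≤ P.natDegree
  · have h := congrArg (fun q => q.coeff k) hQ
    simp only [Q, finsetSum_coeff, coeff_monomial, coeff_zero] at h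
    rw [Finset.sum_ite_eq' (Finset.range (P.natDegree + 1)) k] at h
    rwa [if_pos (Finset.mem_range.2 (Nat.lt_succ_of_le hk))] at h
  · rw [coeff_eq_zero_of_natDegree_lt (not_le.1 hk), map_zero, map_zero]

end Shift

section Straightening

variable {F : Type} [Field F] {G : Type} {n : ℕ}

lemma monOf_cons (v : Fin n × G) (l : List (Fin n × G)) :
    monOf F G (v :: l) = FreeAlgebra.ι F v * monOf F G l := by
  simp [monOf]

lemma lcomm_append {R : Type} [NonUnitalNonAssocRing R] (l : List R) (b : R) :
    ∀ a : R, lcomm a (l ++ [b]) = lcomm a l * b - b * lcomm a l := by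
  induction l with
  | nil => intro a; rfl
  | cons x l ih => intro a; exact ih _

lemma commOf_append {l : List (Fin n × G)} (hl : 2 ≤ l.length) (v : Fin n × G) :
    commOf F G (l ++ [v]) =
      commOf F G l * FreeAlgebra.ι F v - FreeAlgebra.ι F v * commOf F G l := by
  match l, hl with
  | u :: l, _ =>
    simp only [commOf, lcommList, List.map_cons, List.cons_append, List.map_append, List.map_nil]
    exact lcomm_append _ _ _

lemma commOf_mul_eq {l : List (Fin n × G)} (hl : 2 ≤ l.length) (v : Fin n × G)
    (x : FreeAlgebra F (Fin n × G)) :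
    commOf F G l * (FreeAlgebra.ι F v * x) =
      FreeAlgebra.ι F v * (commOf F G l * x) + commOf F G (l ++ [v]) * x := by
  rw [commOf_append hl]
  noncomm_ring

variable [Group G]

lemma ι_mul_mem_BUtot {v : Fin n × G} (hv : v.2 ≠ 1) {s : ℕ} {b : FreeAlgebra F (Fin n × G)}
    (hb : b ∈ BUtot F G n s) : FreeAlgebra.ι F v * b ∈ BUtot F G n (s + 1) := by
  have : BUtot F G n s ≤
      (BUtot F G n (s + 1)).comap (LinearMap.mulLeft F (FreeAlgebra.ι F v)) := by
    refine Submodule.span_le.2 ?_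
    rintro x ⟨pre, cs, hpre, hcs, hlen, rfl⟩
    refine Submodule.subset_span ⟨v :: pre, cs, ?_, hcs, by simpa using hlen, ?_⟩
    · simpa using ⟨hv, fun a b => by simpa using hpre (a, b)⟩
    · rw [monOf_cons, mul_assoc]; rfl
  exact this hb

lemma commOf_mul_generator_mem_BUtot {cs : List (List (Fin n × G))}
    (hcs : ∀ c ∈ cs, 2 ≤ c.length) (pre : List (Fin n × G)) (hpre : ∀ p ∈ pre, p.2 ≠ (1 : G)) :
    ∀ l : List (Fin n × G), 2 ≤ l.length →
      commOf F G l * (monOf F G pre * (cs.map (commOf F G)).prod) ∈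
        BUtot F G n (l.length + (pre ++ cs.flatten).length) := by
  induction pre with
  | nil =>
    intro l hl
    refine Submodule.subset_span ⟨[], l :: cs, by simp, ?_, by simp, by simp [monOf]⟩
    simpa using ⟨hl, hcs⟩
  | cons v pre ih =>
    intro l hl
    have ih := ih fun p hp => hpre p (List.mem_cons_of_mem _ hp)
    rw [monOf_cons, mul_assoc, commOf_mul_eq hl]
    refine add_mem ?_ ?_
    · exact ι_mul_mem_BUtot (hpre v List.mem_cons_self) (ih l hl)
    · have h := ih (l ++ [v]) (by simp; omega)
      convert h using 2
      simp; omega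

lemma commOf_mul_mem_BUtot {l : List (Fin n × G)} (hl : 2 ≤ l.length) {s : ℕ}
    {b : FreeAlgebra F (Fin n × G)} (hb : b ∈ BUtot F G n s) :
    commOf F G l * b ∈ BUtot F G n (l.length + s) := by
  have : BUtot F G n s ≤
      (BUtot F G n (l.length + s)).comap (LinearMap.mulLeft F (commOf F G l)) := by
    refine Submodule.span_le.2 ?_
    rintro x ⟨pre, cs, hpre, hcs, rfl, rfl⟩
    exact commOf_mul_generator_mem_BUtot hcs pre hpre l hl
  exact this hb

lemma MU_le_iff {t q : ℕ} {N : Submodule F (FreeAlgebra F (Fin n × G))} :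
    MU F G n t q ≤ N ↔
      ∀ s, q ≤ s → s ≤ t → ∀ l : List (Fin n × G), (∀ v ∈ l, v.2 = 1) → l.length = t - s →
        ∀ b ∈ BUtot F G n s, monOf F G l * b ∈ N := by
  have hsum : ∀ S : Finset ℕ, (∑ s ∈ S, ReDeg F G n (t - s) * BUtot F G n s) =
      S.sup fun s => ReDeg F G n (t - s) * BUtot F G n s := by
    intro S
    induction S using Finset.induction_on with
    | empty => rfl
    | insert a S ha ih => rw [Finset.sum_insert ha, Finset.sup_insert, ih]; rfl
  rw [MU, hsum, Finset.sup_le_iff]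
  refine ⟨fun h s h₁ h₂ l hl hlen b hb => h s (Finset.mem_Icc.2 ⟨h₁, h₂⟩)
    (Submodule.mul_mem_mul (Submodule.subset_span ⟨l, hl, hlen, rfl⟩) hb), fun h s hs => ?_⟩
  rw [Finset.mem_Icc] at hs
  refine Submodule.mul_le.2 fun r hr b hb => ?_
  have : ReDeg F G n (t - s) ≤ N.comap (LinearMap.mulRight F b) := by
    refine Submodule.span_le.2 ?_
    rintro x ⟨l, hl, hlen, rfl⟩
    exact h s hs.1 hs.2 l hl hlen b hb
  exact this hr

lemma monOf_mul_mem_MU {t q s : ℕ} (hq : q ≤ s) (hs : s ≤ t) {l : List (Fin n × G)}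
    (hl : ∀ v ∈ l, v.2 = 1) (hlen : l.length = t - s) {b : FreeAlgebra F (Fin n × G)}
    (hb : b ∈ BUtot F G n s) : monOf F G l * b ∈ MU F G n t q :=
  MU_le_iff.1 le_rfl s hq hs l hl hlen b hb

lemma ι_mul_mem_MU {t q : ℕ} {v : Fin n × G} (hv : v.2 = 1) {x : FreeAlgebra F (Fin n × G)}
    (hx : x ∈ MU F G n t q) : FreeAlgebra.ι F v * x ∈ MU F G n (t + 1) q := by
  have : MU F G n t q ≤ (MU F G n (t + 1) q).comap (LinearMap.mulLeft F (FreeAlgebra.ι F v)) := by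
    refine MU_le_iff.2 fun s h₁ h₂ l hl hlen b hb => ?_
    have h := monOf_mul_mem_MU (l := v :: l) (t := t + 1) h₁ (by omega)
      (by simpa using ⟨hv, fun a b => by simpa using hl (a, b)⟩)
      (by simp only [List.length_cons]; omega) hb
    rw [monOf_cons, mul_assoc] at h
    exact h
  exact this hx

lemma commOf_mul_monOf_mul_mem_MU {p : ℕ} {b : FreeAlgebra F (Fin n × G)}
    (hb : b ∈ BUtot F G n p) (w : List (Fin n × G)) (hw : ∀ v ∈ w, v.2 = 1) :
    ∀ l : List (Fin n × G), 2 ≤ l.length →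
      commOf F G l * (monOf F G w * b) ∈ MU F G n (l.length + w.length + p) (p + 1) := by
  induction w with
  | nil =>
    intro l hl
    have h := monOf_mul_mem_MU (l := []) (t := l.length + p) (q := p + 1) (by omega) le_rfl
      (by simp) (by simp) (commOf_mul_mem_BUtot hl hb)
    simpa [monOf] using h
  | cons v w ih =>
    intro l hl
    have ih := ih fun p hp => hw p (List.mem_cons_of_mem _ hp)
    rw [monOf_cons, mul_assoc, commOf_mul_eq hl]
    refine add_mem ?_ ?_
    · have h := ι_mul_mem_MU (hw v List.mem_cons_self) (ih l hl)
      convert h using 2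
      simp; omega
    · have h := ih (l ++ [v]) (by simp; omega)
      convert h using 2
      simp; omega

/-- Permuting the `e`-variables of a word only changes it modulo the next filtration step. -/
lemma monOf_mul_sub_monOf_mul_mem_MU_of_perm {p : ℕ} {b : FreeAlgebra F (Fin n × G)}
    (hb : b ∈ BUtot F G n p) {w w' : List (Fin n × G)} (h : w.Perm w') :
    (∀ v ∈ w, v.2 = 1) →
      monOf F G w * b - monOf F G w' * b ∈ MU F G n (w.length + p) (p + 1) := by
  induction h with
  | nil => intro _; simp
  | cons v h ih =>
    intro hw
    have := ι_mul_mem_MU (hw v List.mem_cons_self)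
      (ih fun p hp => hw p (List.mem_cons_of_mem _ hp))
    rw [monOf_cons, monOf_cons, mul_assoc, mul_assoc, ← mul_sub]
    convert this using 2
    simp; omega
  | swap u v l =>
    intro hw
    have := commOf_mul_monOf_mul_mem_MU hb l (fun p hp => hw p (by simp [hp])) [v, u] (by simp)
    convert this using 1
    · congr 1; simp; omega
    · simp only [monOf_cons, commOf, lcommList, lcomm, List.map_cons, List.map_nil]
      noncomm_ring
  | trans h₁ h₂ ih₁ ih₂ =>
    intro hw
    have h := add_mem (ih₁ hw)
      (h₁.length_eq ▸ ih₂ fun v hv => hw v (h₁.mem_iff.2 hv))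
    simpa using h

/-- The word underlying `eMon`. -/
def eWord (G : Type) [Group G] (α : Fin n → ℕ) : List (Fin n × G) :=
  (List.finRange n).flatMap fun i => List.replicate (α i) (i, (1 : G))

lemma eMon_eq_monOf (α : Fin n → ℕ) : eMon F G n α = monOf F G (eWord G α) := rfl

lemma snd_eq_one_of_mem_eWord {α : Fin n → ℕ} {v : Fin n × G} (hv : v ∈ eWord G α) :
    v.2 = 1 := by
  simp only [eWord, List.mem_flatMap, List.mem_replicate] at hv
  obtain ⟨i, -, -, rfl⟩ := hv
  rfl

lemma length_eWord (α : Fin n → ℕ) : (eWord G α).length = ∑ i, α i := by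
  simp [eWord, List.length_flatMap, ← List.ofFn_eq_map, List.sum_ofFn]

lemma prod_map_eWord (α : Fin n → ℕ) (c : Fin n × G → F) :
    ((eWord G α).map c).prod = ∏ i, c (i, 1) ^ α i := by
  simp [eWord, List.flatMap_def, List.prod_flatten, Function.comp_def,
    ← List.ofFn_eq_map, List.prod_ofFn]

lemma exists_perm_eWord {w : List (Fin n × G)} (hw : ∀ v ∈ w, v.2 = 1) :
    ∃ α : Fin n → ℕ, w.Perm (eWord G α) := by
  induction w with
  | nil => exact ⟨0, by simp [eWord, List.flatMap_def]⟩
  | cons v w ih =>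
    classical
    refine ⟨fun i => (v :: w).count (i, 1), ?_⟩
    rw [List.perm_iff_count]
    rintro ⟨i, g⟩
    by_cases hg : g = 1
    · subst hg
      simp only [eWord, List.count_flatMap, Function.comp_def, List.count_replicate, beq_iff_eq,
        Prod.mk.injEq, and_true, ← List.ofFn_eq_map, List.sum_ofFn]
      simp
    · rw [List.count_eq_zero_of_not_mem fun h => hg (hw _ h),
        List.count_eq_zero_of_not_mem fun h => hg (snd_eq_one_of_mem_eWord h)]

end Straightening

theorem stmt15 {F G W : Type} [Field F] [IsAlgClosed F] [CharZero F]
    [Group G] [Finite G] [DecidableEq G]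
    [Ring W] [Algebra F W]
    (grading : G → Submodule F W)
    (hdecomp : DirectSum.IsInternal grading)
    (hgmul : ∀ (g h : G), ∀ a ∈ grading g, ∀ b ∈ grading h, a * b ∈ grading (g * h))
    (hone : (1 : W) ∈ grading 1)
    (haffine : ∃ S : Finset W, Algebra.adjoin F (S : Set W) = ⊤)
    (hPI : SatisfiesOrdinaryPI F W)
    (n t p : ℕ) (hp : p ≤ t) (k : ℕ)
    -- `f 1, …, f k` are (representatives of) a basis of `B_n^{(p)}` consisting of
    -- `e`-multihomogeneous elements:
    (f : Fin k → FreeAlgebra F (Fin n × G))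
    (hfB : ∀ j, f j ∈ BUtot F G n p)
    (hfhom : ∀ j, ∃ γ : Fin n → ℕ, f j ∈ EHom F G n γ)
    (hfindep : LinearIndependent F (fun j => (IdU F G W grading n).mkQ (f j)))
    (hfspan : Submodule.span F (Set.range fun j => (IdU F G W grading n).mkQ (f j)) =
      Submodule.map (IdU F G W grading n).mkQ (BUtot F G n p)) :
    -- the images of the `x_{1,e}^{α₁}⋯x_{n,e}^{α_n}·f j`, for `|α| = t - p`, form a basis
    -- of `M_p/M_{p+1}`, realized as the image of `M_p` in `R_n^G(W) ⧸ M_{p+1}`: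
    LinearIndependent F
      (fun q : {α : Fin n → ℕ // ∑ i, α i = t - p} × Fin k =>
        Submodule.Quotient.mk
          (p := Submodule.map (IdU F G W grading n).mkQ (MU F G n t (p + 1)))
          ((IdU F G W grading n).mkQ (eMon F G n q.1.1 * f q.2))) ∧
    Submodule.span F
      (Set.range
        (fun q : {α : Fin n → ℕ // ∑ i, α i = t - p} × Fin k =>
          Submodule.Quotient.mk
            (p := Submodule.map (IdU F G W grading n).mkQ (MU F G n t (p + 1)))
            ((IdU F G W grading n).mkQ (eMon F G n q.1.1 * f q.2)))) =
      Submodule.map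
        (Submodule.map (IdU F G W grading n).mkQ (MU F G n t (p + 1))).mkQ
        (Submodule.map (IdU F G W grading n).mkQ (MU F G n t p)) := by
  classical
  set I := IdU F G W grading n with hI
  have hmem : ∀ (α : {α : Fin n → ℕ // ∑ i, α i = t - p}), ∀ b ∈ BUtot F G n p,
      eMon F G n α.1 * b ∈ MU F G n t p := fun α b hb => by
    rw [eMon_eq_monOf]
    exact monOf_mul_mem_MU le_rfl hp (fun v => snd_eq_one_of_mem_eWord)
      (by rw [length_eWord, α.2]) hb
  constructor
  · rw [linearIndependent_iff']
    intro S g hg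
    have hg' : I.mkQ (∑ q ∈ S, g q • (eMon F G n q.1.1 * f q.2)) ∈
        Submodule.map I.mkQ (MU F G n t (p + 1)) := by
      rw [← Submodule.Quotient.mk_eq_zero, ← hg]
      simp only [map_sum, map_smul]
      exact map_sum (Submodule.mkQ _) _ _
    obtain ⟨m, hm, hmg⟩ := hg'
    have hI' : (∑ q ∈ S, g q • (eMon F G n q.1.1 * f q.2)) - m ∈ I := by
      rw [← Submodule.ker_mkQ I, LinearMap.mem_ker, map_sub, hmg, sub_self]
    have key : ∀ (c : Fin n → F) (j : Fin k),
        ∑ q ∈ S, (if q.2 = j then g q * ∏ i, c i ^ q.1.1 i else 0) = 0 := by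
      intro c
      let c' : Fin n × G → F := fun v => if v.2 = 1 then c v.1 else 0
      have hc' : ∀ v, v.2 ≠ 1 → c' v = 0 := fun v hv => if_neg hv
      let L : FreeAlgebra F (Fin n × G) →ₗ[F] FreeAlgebra F (Fin n × G) :=
        (Polynomial.lcoeff (FreeAlgebra F (Fin n × G)) (t - p)).restrictScalars F ∘ₗ
          (shiftHom c').toLinearMap
      have hL : ∀ x, L x = (shiftHom c' x).coeff (t - p) := fun x => rfl
      have hLm : L m = 0 := by
        have : MU F G n t (p + 1) ≤ LinearMap.ker L := by
          refine MU_le_iff.2 fun s h₁ h₂ l hl hlen b hb => ?_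
          rw [LinearMap.mem_ker, hL, map_mul, shiftHom_eq_C_of_mem_BUtot hc' hb,
            Polynomial.coeff_mul_C, Polynomial.coeff_eq_zero_of_natDegree_lt, zero_mul]
          exact (natDegree_shiftHom_monOf_le c' l).trans_lt (by omega)
        exact this hm
      have hLq : ∀ q : {α : Fin n → ℕ // ∑ i, α i = t - p} × Fin k,
          L (eMon F G n q.1.1 * f q.2) = (∏ i, c i ^ q.1.1 i) • f q.2 := by
        intro q
        have h := coeff_shiftHom_monOf c' (eWord G q.1.1)
        rw [length_eWord, q.1.2, prod_map_eWord] at h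
        rw [hL, map_mul, shiftHom_eq_C_of_mem_BUtot hc' (hfB _), Polynomial.coeff_mul_C,
          eMon_eq_monOf, h, ← Algebra.smul_def]
        simp [c']
      have h := coeff_shiftHom_mem_IdU hone hc' hI' (t - p)
      rw [← hL, map_sub, hLm, sub_zero, map_sum] at h
      rw [← hI, ← Submodule.ker_mkQ I, LinearMap.mem_ker] at h
      refine Fintype.linearIndependent_iff.1 hfindep _ ?_
      rw [← h, map_sum]
      simp only [Finset.sum_smul, ite_smul, zero_smul]
      rw [Finset.sum_comm]
      refine Finset.sum_congr rfl fun q _ => ?_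
      rw [Finset.sum_ite_eq, if_pos (Finset.mem_univ _), mul_smul, map_smul, map_smul, hLq, map_smul]
    rintro ⟨α, j⟩ hq
    let P : MvPolynomial (Fin n) F := ∑ q ∈ S,
      if q.2 = j then MvPolynomial.monomial (Finsupp.equivFunOnFinite.symm q.1.1) (g q) else 0
    have hP : P = 0 := by
      refine MvPolynomial.funext fun c => ?_
      rw [map_zero, ← key c j, map_sum]
      refine Finset.sum_congr rfl fun q _ => ?_
      split_ifs
      · rw [MvPolynomial.eval_monomial, Finsupp.prod_fintype _ _ (by simp)]
        rfl
      · exact map_zero _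
    have h := congrArg (MvPolynomial.coeff (Finsupp.equivFunOnFinite.symm α.1)) hP
    rw [MvPolynomial.coeff_zero, MvPolynomial.coeff_sum, Finset.sum_eq_single (α, j)] at h
    · simpa using h
    · rintro ⟨β, i⟩ - hne
      by_cases hij : i = j
      · subst hij
        rw [if_pos rfl, MvPolynomial.coeff_monomial, if_neg]
        intro h
        exact hne (Prod.ext (Subtype.ext (Finsupp.equivFunOnFinite.symm.injective h)) rfl)
      · rw [if_neg hij, MvPolynomial.coeff_zero]
    · exact fun h => absurd hq h
  · set N := Submodule.map I.mkQ (MU F G n t (p + 1)) with hN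
    refine le_antisymm (Submodule.span_le.2 ?_) ?_
    · rintro _ ⟨q, rfl⟩
      exact Submodule.mem_map_of_mem (Submodule.mem_map_of_mem (hmem q.1 _ (hfB q.2)))
    rw [← Submodule.map_comp, Submodule.map_le_iff_le_comap, MU_le_iff]
    intro s h₁ h₂ l hl hlen b hb
    rw [Submodule.mem_comap]
    have hzero : ∀ x ∈ MU F G n t (p + 1), (N.mkQ ∘ₗ I.mkQ) x = 0 := fun x hx => by
      rw [LinearMap.comp_apply, ← LinearMap.mem_ker, Submodule.ker_mkQ]
      exact Submodule.mem_map_of_mem hx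
    obtain rfl | hlt := h₁.eq_or_lt
    swap
    · rw [hzero _ (monOf_mul_mem_MU hlt h₂ hl hlen hb)]
      exact zero_mem _
    obtain ⟨α, hα⟩ := exists_perm_eWord hl
    have hαsum : ∑ i, α i = t - p := by rw [← length_eWord (G := G), ← hα.length_eq, hlen]
    have hperm := monOf_mul_sub_monOf_mul_mem_MU_of_perm hb hα hl
    rw [hlen, Nat.sub_add_cancel hp] at hperm
    have heq := hzero _ hperm
    rw [map_sub, sub_eq_zero] at heq
    rw [heq, ← eMon_eq_monOf]
    have hbspan : I.mkQ b ∈ Submodule.span F (Set.range fun j => I.mkQ (f j)) := by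
      rw [hfspan]
      exact Submodule.mem_map_of_mem hb
    obtain ⟨d, hd⟩ := (Submodule.mem_span_range_iff_exists_fun F).1 hbspan
    have hbI : b - ∑ j, d j • f j ∈ I := by
      rw [← Submodule.ker_mkQ I, LinearMap.mem_ker, map_sub, map_sum, sub_eq_zero, ← hd]
      simp
    have hEI : I.mkQ (eMon F G n α * b) = I.mkQ (eMon F G n α * ∑ j, d j • f j) := by
      rw [← sub_eq_zero, ← map_sub, ← LinearMap.mem_ker, Submodule.ker_mkQ, ← mul_sub]
      exact mul_mem_IdU _ hbI
    rw [LinearMap.comp_apply, hEI, Finset.mul_sum, map_sum, map_sum]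
    refine Submodule.sum_mem _ fun j _ => ?_
    rw [mul_smul_comm, map_smul, map_smul]
    exact Submodule.smul_mem _ _ (Submodule.subset_span ⟨(⟨α, hαsum⟩, j), rfl⟩)
end
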